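/- Let $G$ be an affine algebraic group scheme over a field $k$, and let $k'/k$ be a separable algebraic field extension. Then the base change $\mathrm{Rad}_u(G)_{k'}$ equals $\mathrm{Rad}_u(G_{k'})$. -/

import Mathlib

/- # Preliminaries: affine group schemes via commutative Hopf algebras

An affine algebraic group scheme `G` over a field `k` is encoded by its coordinate
Hopf algebra `A = O(G)` (a commutative Hopf `k`-algebra of finite type).  The group
of `R`-points is `G(R) = Hom_{k-alg}(A, R)`, with multiplication given by
convolution through the comultiplication.  Closed subgroup schemes are encoded by
surjective maps of Hopf algebras `A →ₐc[k] B`. -/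

open TensorProduct

noncomputable section

/-- The product of two `R`-points of the affine group scheme `Spec A`,
given by convolution through the comultiplication of `A`. -/
def ptMul {k A R : Type} [CommRing k] [CommRing A] [Bialgebra k A]
    [CommRing R] [Algebra k R] (f g : A →ₐ[k] R) : A →ₐ[k] R :=
  (Algebra.TensorProduct.productMap f g).comp (Bialgebra.comulAlgHom k A)

/-- The identity `R`-point of the affine group scheme `Spec A`. -/
def ptOne {k A : Type} [CommRing k] [CommRing A] [Bialgebra k A]
    (R : Type) [CommRing R] [Algebra k R] : A →ₐ[k] R :=
  (Algebra.ofId k R).comp (Bialgebra.counitAlgHom k A)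

/-- A closed subgroup scheme of the affine group scheme `Spec A`, encoded by a
surjection of commutative Hopf algebras `π : A → B`; the subgroup is `Spec B`. -/
structure ClosedSubgrp (k A : Type) [CommRing k] [CommRing A] [HopfAlgebra k A] where
  B : Type
  [commRing : CommRing B]
  [hopf : HopfAlgebra k B]
  π : A →ₐc[k] B
  surj : Function.Surjective π

attribute [instance] ClosedSubgrp.commRing ClosedSubgrp.hopf

namespace ClosedSubgrp

variable {k A : Type} [CommRing k] [CommRing A] [HopfAlgebra k A]

/-- An `R`-point of `Spec A` lies in the closed subgroup iff it factors through `π`. -/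
def mem (H : ClosedSubgrp k A) {R : Type} [CommRing R] [Algebra k R]
    (f : A →ₐ[k] R) : Prop :=
  ∃ g : H.B →ₐ[k] R, f = g.comp (H.π : A →ₐ[k] H.B)

/-- Containment of closed subgroup schemes, tested on points. -/
def le (H H' : ClosedSubgrp k A) : Prop :=
  ∀ (R : Type) [CommRing R] [Algebra k R], ∀ f : A →ₐ[k] R, H.mem f → H'.mem f

/-- Normality of a closed subgroup scheme, tested on points:
for every `g ∈ G(R)` and `f ∈ H(R)` the conjugate `g f g⁻¹` lies in `H(R)`
(phrased multiplicatively: `g * f = f' * g` for some `f' ∈ H(R)`). -/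
def Normal (H : ClosedSubgrp k A) : Prop :=
  ∀ (R : Type) [CommRing R] [Algebra k R], ∀ f g : A →ₐ[k] R,
    H.mem f → ∃ f' : A →ₐ[k] R, H.mem f' ∧ ptMul g f = ptMul f' g

/-- The closed subgroup scheme is trivial: all its points are the identity. -/
def Trivial (H : ClosedSubgrp k A) : Prop :=
  ∀ (R : Type) [CommRing R] [Algebra k R], ∀ f : A →ₐ[k] R, H.mem f → f = ptOne R

end ClosedSubgrp

/-- A (right) comodule structure on `V` over the coalgebra underlying `B`;
equivalently, a linear representation of the affine group scheme `Spec B`. -/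
structure Coaction (k B V : Type) [CommRing k] [CommRing B] [Bialgebra k B]
    [AddCommGroup V] [Module k V] where
  ρ : V →ₗ[k] V ⊗[k] B
  counit_law : ∀ v : V,
    TensorProduct.rid k V (LinearMap.lTensor V (Coalgebra.counit (R := k) (A := B)) (ρ v)) = v
  coassoc : ∀ v : V, LinearMap.rTensor B ρ (ρ v)
      = (TensorProduct.assoc k V B B).symm
          (LinearMap.lTensor V (Coalgebra.comul (R := k) (A := B)) (ρ v))

/-- The affine group scheme `Spec B` is unipotent: every nonzero finite-dimensional
linear representation has a nonzero fixed vector. -/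
def IsUnipotentHopf (k B : Type) [CommRing k] [CommRing B] [HopfAlgebra k B] : Prop :=
  ∀ (V : Type) [AddCommGroup V] [Module k V] [Module.Finite k V],
    ∀ c : Coaction k B V, Nontrivial V → ∃ v : V, v ≠ 0 ∧ c.ρ v = v ⊗ₜ[k] (1 : B)

/-- `U` is the restricted unipotent radical of `Spec A`: a unipotent normal closed
subgroup scheme containing every unipotent normal closed subgroup scheme. -/
def IsRadU {k A : Type} [CommRing k] [CommRing A] [HopfAlgebra k A]
    (U : ClosedSubgrp k A) : Prop :=
  U.Normal ∧ IsUnipotentHopf k U.B ∧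
    ∀ H : ClosedSubgrp k A, H.Normal → IsUnipotentHopf k H.B → H.le U

/-- The affine group scheme `Spec A` is commutative. -/
def IsCommutativeHopf (k A : Type) [CommRing k] [CommRing A] [Bialgebra k A] : Prop :=
  ∀ (R : Type) [CommRing R] [Algebra k R], ∀ f g : A →ₐ[k] R, ptMul f g = ptMul g f

/-- `A'`, a Hopf algebra over a field extension `K` of `k`, presents the base change
to `K` of the affine group scheme `Spec A`: there is a natural multiplicative
bijection between the points of `Spec A'` over any `K`-algebra `R` and the points of
`Spec A` over `R` (viewed as a `k`-algebra). -/
structure BaseChangePresentation (k K A A' : Type) [CommRing k] [CommRing K]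
    [Algebra k K] [CommRing A] [HopfAlgebra k A] [CommRing A'] [HopfAlgebra K A'] where
  e : ∀ (R : Type) (_ : CommRing R) (_ : Algebra k R) (_ : Algebra K R)
      (_ : IsScalarTower k K R), (A' →ₐ[K] R) → (A →ₐ[k] R)
  bij : ∀ (R : Type) (iR : CommRing R) (ik : Algebra k R) (iK : Algebra K R)
      (it : IsScalarTower k K R), Function.Bijective (e R iR ik iK it)
  mul : ∀ (R : Type) (iR : CommRing R) (ik : Algebra k R) (iK : Algebra K R)
      (it : IsScalarTower k K R), ∀ f g : A' →ₐ[K] R,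
      e R iR ik iK it (ptMul f g) = ptMul (e R iR ik iK it f) (e R iR ik iK it g)
  natural : ∀ (R R' : Type) (iR : CommRing R) (ik : Algebra k R) (iK : Algebra K R)
      (it : IsScalarTower k K R) (iR' : CommRing R') (ik' : Algebra k R')
      (iK' : Algebra K R') (it' : IsScalarTower k K R'),
      ∀ (φ : R →ₐ[K] R') (f : A' →ₐ[K] R),
        e R' iR' ik' iK' it' (φ.comp f)
          = ((φ.restrictScalars k).comp (e R iR ik iK it f) : A →ₐ[k] R')

open scoped Matrix.Module in
theorem exists_equivariant_projection {k K ι : Type} [Field k] [Field K] [Algebra k K]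
    [Fintype ι] [DecidableEq ι] (S : Set (Matrix ι ι k))
    (hS : ∀ W : Submodule k (ι → k), (∀ M ∈ S, ∀ w ∈ W, M • w ∈ W) → W = ⊥ ∨ W = ⊤)
    (T : Submodule k (ι → K)) (hT : ∀ M ∈ S, ∀ t ∈ T, M • t ∈ T) :
    ∃ p : (ι → K) →ₗ[k] (ι → K), (∀ v, p v ∈ T) ∧ (∀ t ∈ T, p t = t) ∧
      ∀ M ∈ S, ∀ v, p (M • v) = M • p v := by
  let E := Algebra.adjoin k S
  have adj : ∀ (V : Type) [AddCommGroup V] [Module k V] (W : Submodule k (ι → V)),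
      (∀ M ∈ S, ∀ w ∈ W, M • w ∈ W) → ∀ M ∈ E, ∀ w ∈ W, M • w ∈ W := by
    intro V _ _ W hW M hM
    induction hM using Algebra.adjoin_induction with
    | mem x hx => exact hW x hx
    | algebraMap r =>
      intro w hw
      have : (algebraMap k (Matrix ι ι k) r) • w = r • w := by
        rw [Matrix.algebraMap_eq_diagonal]
        exact Matrix.Module.diagonal_const_smul r w
      rw [this]
      exact W.smul_mem r hw
    | add x y _ _ hx hy =>
      intro w hw
      rw [add_smul]
      exact W.add_mem (hx w hw) (hy w hw)
    | mul x y _ _ hx hy =>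
      intro w hw
      rw [mul_smul]
      exact hx _ (hy w hw)
  have toSub : ∀ (V : Type) [AddCommGroup V] [Module k V] (W : Submodule E (ι → V)) (r : k)
      (w : ι → V), w ∈ W → r • w ∈ W := by
    intro V _ _ W r w hw
    have := W.smul_mem (algebraMap k E r) hw
    have h2 : (algebraMap k E r) • w = r • w := by
      change (algebraMap k (Matrix ι ι k) r) • w = r • w
      rw [Matrix.algebraMap_eq_diagonal]
      exact Matrix.Module.diagonal_const_smul r w
    rwa [h2] at this
  have hsimple : IsSemisimpleModule E (ι → k) := by
    rw [isSemisimpleModule_iff]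
    refine ⟨fun W => ?_⟩
    let W' : Submodule k (ι → k) := { W with smul_mem' := fun r w hw => toSub k W r w hw }
    rcases hS W' (fun M hM w hw => W.smul_mem (⟨M, Algebra.subset_adjoin hM⟩ : E) hw) with h | h
    · have : W = ⊥ := by
        ext x
        have := congrArg (fun Z => x ∈ Z) h
        simpa [W'] using this
      exact ⟨⊤, this ▸ isCompl_bot_top⟩
    · have : W = ⊤ := by
        ext x
        have := congrArg (fun Z => x ∈ Z) h
        simpa [W'] using this
      exact ⟨⊥, this ▸ isCompl_top_bot⟩
  let j : K → (ι → k) →ₗ[E] (ι → K) := fun κ =>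
    ((LinearMap.toSpanSingleton k K κ).mapMatrixModule ι).restrictScalars E
  have hss : IsSemisimpleModule E (ι → K) := by
    refine isSemisimpleModule_of_isSemisimpleModule_submodule' (p := fun κ => (j κ).range)
      (fun κ => .range _) ?_
    rw [eq_top_iff]
    intro v _
    have : v = ∑ i, j (v i) (Pi.single i 1) := by
      ext l
      simp [j, Finset.sum_apply, Pi.single_apply, ite_smul]
    rw [this]
    exact Submodule.sum_mem _ fun i _ => Submodule.mem_iSup_of_mem (v i) ⟨_, rfl⟩
  let T' : Submodule E (ι → K) := { T with smul_mem' := fun M w hw => adj K T hT M.1 M.2 w hw }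
  obtain ⟨C, hC⟩ := exists_isCompl T'
  let q := T'.projectionOnto C hC
  let qk : (ι → K) →ₗ[k] (ι → K) :=
    { toFun := fun v => q v
      map_add' := by simp
      map_smul' := by
        intro r v
        have h2 : ∀ v : ι → K, (algebraMap k E r) • v = r • v := by
          intro w
          change (algebraMap k (Matrix ι ι k) r) • w = r • w
          rw [Matrix.algebraMap_eq_diagonal]
          exact Matrix.Module.diagonal_const_smul r w
        have := congrArg Subtype.val (q.map_smul (algebraMap k E r) v)
        rw [h2] at this
        rw [this]
        exact h2 _ }
  refine ⟨qk, fun v => (q v).2, fun t ht => ?_, fun M hM v => ?_⟩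
  · exact congrArg Subtype.val (Submodule.projectionOnto_apply_left hC (⟨t, ht⟩ : T'))
  · exact congrArg Subtype.val (q.map_smul (⟨M, Algebra.subset_adjoin hM⟩ : E) v)

open scoped Matrix.Module in
theorem exists_stable_isCompl {k K ι : Type} [Field k] [Field K] [Algebra k K]
    [Algebra.IsSeparable k K] [Fintype ι] [DecidableEq ι] (S : Set (Matrix ι ι k))
    (hS : ∀ W : Submodule k (ι → k), (∀ M ∈ S, ∀ w ∈ W, M • w ∈ W) → W = ⊥ ∨ W = ⊤)
    (T : Submodule K (ι → K)) (hT : ∀ M ∈ S, ∀ t ∈ T, M • t ∈ T) :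
    ∃ T' : Submodule K (ι → K), IsCompl T T' ∧ ∀ M ∈ S, ∀ t ∈ T', M • t ∈ T' := by
  obtain ⟨p, hpT, hpid, hpM⟩ := exists_equivariant_projection S hS (T.restrictScalars k) hT
  obtain ⟨s, hs⟩ := IsNoetherian.noetherian T
  let L : IntermediateField k K := IntermediateField.adjoin k (⋃ t ∈ s, Set.range t)
  have hfin : Finite (⋃ t ∈ s, Set.range t : Set K) :=
    (s.finite_toSet.biUnion fun t _ => Set.finite_range t).to_subtype
  have : FiniteDimensional k L :=
    IntermediateField.finiteDimensional_adjoin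
      (fun x _ => (Algebra.IsSeparable.isSeparable k x).isIntegral)
  have : Algebra.FormallyUnramified k L := .of_isSeparable k L
  let Φ : (ι → K) → (L ⊗[k] L →ₗ[k] (ι → K)) := fun v => TensorProduct.lift
    (LinearMap.mk₂ k (fun x y : L => x • p (y • v)) (by intros; simp [add_smul])
      (by intros; simp) (by intros; simp [add_smul]) (by
        intro c x y
        rw [smul_assoc, map_smul, smul_comm]))
  have hΦ : ∀ v (x y : L), Φ v (x ⊗ₜ y) = x • p (y • v) := fun v x y => rfl
  have hΦadd : ∀ (v : ι → ι → K) (z : L ⊗[k] L), ∑ i, Φ (v i) z = Φ (∑ i, v i) z := by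
    intro v z
    induction z with
    | zero => simp
    | add a b ha hb => simp [Finset.sum_add_distrib, ha, hb]
    | tmul x y => simp [hΦ, Finset.smul_sum]
  have hΦsmul : ∀ (c : k) (v : ι → K) (z : L ⊗[k] L), Φ (c • v) z = c • Φ v z := by
    intro c v z
    induction z with
    | zero => simp
    | add a b ha hb => simp [ha, hb]
    | tmul x y => rw [hΦ, hΦ, smul_comm y c, map_smul, smul_comm]
  have hΦM : ∀ M ∈ S, ∀ (v : ι → K) (z : L ⊗[k] L), Φ (M • v) z = M • Φ v z := by
    intro M hM v z
    have hc : ∀ (l : L) (v : ι → K), M • (l • v) = l • (M • v) := by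
      intro l v
      ext i
      simp only [Matrix.Module.smul_apply, Pi.smul_apply, Finset.smul_sum]
      exact Finset.sum_congr rfl fun j _ => smul_comm _ _ _
    induction z with
    | zero => simp
    | add a b ha hb => simp [ha, hb]
    | tmul x y => rw [hΦ, hΦ, ← hc, hpM M hM, hc]
  have hΦT : ∀ (v : ι → K) (z : L ⊗[k] L), Φ v z ∈ T := by
    intro v z
    induction z with
    | zero => simp
    | add a b ha hb => rw [map_add]; exact T.add_mem ha hb
    | tmul x y => exact T.smul_mem (x : K) (hpT _)
  have hΦl : ∀ (l : L) (v : ι → K) (z : L ⊗[k] L),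
      l • Φ v z = Φ v ((l ⊗ₜ 1) * z) := by
    intro l v z
    induction z with
    | zero => simp
    | add a b ha hb => simp [mul_add, ha, hb]
    | tmul x y => simp [hΦ, mul_smul]
  have hΦr : ∀ (l : L) (v : ι → K) (z : L ⊗[k] L),
      Φ v ((1 ⊗ₜ l) * z) = Φ (l • v) z := by
    intro l v z
    induction z with
    | zero => simp
    | add a b ha hb => simp [mul_add, ha, hb]
    | tmul x y =>
      rw [Algebra.TensorProduct.tmul_mul_tmul, one_mul, hΦ, hΦ, mul_comm, mul_smul]
  let e := Algebra.FormallyUnramified.elem k L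
  let P : (ι → K) →ₗ[K] (ι → K) :=
    ∑ i, (LinearMap.proj i : (ι → K) →ₗ[K] K).smulRight (Φ (Pi.single i 1) e)
  have hP : ∀ v, P v = ∑ i, v i • Φ (Pi.single i 1) e := by
    intro v; simp [P, LinearMap.sum_apply]
  have hPT : ∀ v, P v ∈ T := by
    intro v
    rw [hP]
    exact T.sum_mem fun i _ => T.smul_mem _ (hΦT _ _)
  have hPs : ∀ t ∈ s, P t = t := by
    intro t ht
    have htT : t ∈ T := hs ▸ Submodule.subset_span ht
    have hl : ∀ i, ∃ l : L, (l : K) = t i := fun i =>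
      ⟨⟨t i, IntermediateField.subset_adjoin _ _
        (Set.mem_biUnion (show t ∈ (s : Set (ι → K)) from ht) ⟨i, rfl⟩)⟩, rfl⟩
    choose l hl using hl
    have h1 : ∀ z : L ⊗[k] L, Φ t z = (Algebra.TensorProduct.lmul' k z) • t := by
      intro z
      induction z with
      | zero => simp
      | add a b ha hb => simp [ha, hb, add_smul]
      | tmul x y =>
        rw [hΦ, hpid (y • t) (T.smul_mem (y : K) htT)]
        simp [mul_smul]
    calc P t = ∑ i, l i • Φ (Pi.single i 1) e := by
          rw [hP]
          refine Finset.sum_congr rfl fun i _ => ?_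
          rw [← hl]; rfl
      _ = ∑ i, Φ (l i • Pi.single i 1) e := by
          refine Finset.sum_congr rfl fun i _ => ?_
          rw [hΦl, ← Algebra.FormallyUnramified.one_tmul_mul_elem, hΦr]
      _ = Φ t e := by
          rw [hΦadd]
          refine congrArg (fun w => Φ w e) ?_
          ext j
          simp [Finset.sum_apply, Pi.single_apply, ← hl, IntermediateField.smul_def]
      _ = t := by
          rw [h1, Algebra.FormallyUnramified.lmul_elem, one_smul]
  have hPid : ∀ t ∈ T, P t = t := by
    intro t ht
    rw [← hs] at ht
    exact LinearMap.eqOn_span (f := P) (g := LinearMap.id) (s := (s : Set (ι → K))) hPs ht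
  have hPM : ∀ M ∈ S, ∀ v, P (M • v) = M • P v := by
    intro M hM v
    have h1 : ∀ j, M • Φ (Pi.single j 1) e = ∑ i, M i j • Φ (Pi.single i 1) e := by
      intro j
      rw [← hΦM M hM]
      simp_rw [← hΦsmul]
      rw [hΦadd]
      refine congrArg (fun w => Φ w e) ?_
      ext i
      simp [Finset.sum_apply, Pi.single_apply]
    have hc : ∀ (l : K) (v : ι → K), M • (l • v) = l • (M • v) := by
      intro l v
      ext i
      simp [Finset.mul_sum]
    rw [hP, hP, Finset.smul_sum]
    simp_rw [hc, h1, Finset.smul_sum, Matrix.Module.smul_apply, Finset.sum_smul]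
    rw [Finset.sum_comm]
    refine Finset.sum_congr rfl fun i _ => Finset.sum_congr rfl fun j _ => ?_
    rw [smul_assoc, smul_comm]
  let P' : (ι → K) →ₗ[K] T := P.codRestrict T hPT
  refine ⟨P'.ker, LinearMap.isCompl_of_proj (f := P') fun x => Subtype.ext (hPid x x.2),
    fun M hM t ht => ?_⟩
  have : P t = 0 := congrArg Subtype.val ht
  refine Subtype.ext ?_
  change P (M • t) = 0
  rw [hPM M hM, this, smul_zero]

theorem TensorProduct.eq_zero_of_forall_lTensor {k V B : Type} [Field k] [AddCommGroup V]
    [Module k V] [AddCommGroup B] [Module k B] (z : V ⊗[k] B)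
    (h : ∀ ψ : B →ₗ[k] k, TensorProduct.rid k V (LinearMap.lTensor V ψ z) = 0) : z = 0 := by
  classical
  let b := Module.Basis.ofVectorSpace k B
  have key : ∀ (z : V ⊗[k] B) i, TensorProduct.equivFinsuppOfBasisRight b z i
      = TensorProduct.rid k V (LinearMap.lTensor V (b.coord i) z) := by
    intro z i
    induction z with
    | zero => simp
    | add x y hx hy => simp [hx, hy]
    | tmul v y => simp
  apply (TensorProduct.equivFinsuppOfBasisRight b).injective
  ext i
  rw [key, h, map_zero, Finsupp.zero_apply]

namespace Coaction

section Ring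

variable {k B V V' : Type} [CommRing k] [CommRing B] [Bialgebra k B]
  [AddCommGroup V] [Module k V] [AddCommGroup V'] [Module k V']

/-- The operator on a comodule induced by a linear functional on the coalgebra. -/
def act (c : Coaction k B V) (ψ : B →ₗ[k] k) : V →ₗ[k] V :=
  (TensorProduct.rid k V).toLinearMap ∘ₗ LinearMap.lTensor V ψ ∘ₗ c.ρ

/-- The matrix coefficients of a comodule. -/
def coef (c : Coaction k B V) (φ : V →ₗ[k] k) : V →ₗ[k] B :=
  (TensorProduct.lid k B).toLinearMap ∘ₗ LinearMap.rTensor B φ ∘ₗ c.ρ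

/-- A subspace is stable when it is preserved by all the operators `act ψ`. -/
def Stable (c : Coaction k B V) (W : Submodule k V) : Prop :=
  ∀ ψ, ∀ w ∈ W, c.act ψ w ∈ W

theorem act_counit (c : Coaction k B V) (v : V) : c.act Coalgebra.counit v = v :=
  c.counit_law v

theorem apply_coef (c : Coaction k B V) (φ : V →ₗ[k] k) (ψ : B →ₗ[k] k) (v : V) :
    ψ (c.coef φ v) = φ (c.act ψ v) := by
  simp only [act, coef, LinearMap.comp_apply]
  induction c.ρ v with
  | zero => simp
  | add x y hx hy => simp only [map_add, hx, hy]
  | tmul x y => simp [mul_comm]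

theorem act_act (c : Coaction k B V) (ψ ψ' : B →ₗ[k] k) (v : V) :
    c.act ψ (c.act ψ' v) =
      c.act ((TensorProduct.lid k k).toLinearMap ∘ₗ TensorProduct.map ψ ψ' ∘ₗ
        Coalgebra.comul) v := by
  let F : (V ⊗[k] B) ⊗[k] B →ₗ[k] V :=
    (TensorProduct.rid k V).toLinearMap ∘ₗ LinearMap.lTensor V ψ ∘ₗ
      (TensorProduct.rid k (V ⊗[k] B)).toLinearMap ∘ₗ LinearMap.lTensor (V ⊗[k] B) ψ'
  have h1 : ∀ z : V ⊗[k] B, F (LinearMap.rTensor B c.ρ z)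
      = c.act ψ (TensorProduct.rid k V (LinearMap.lTensor V ψ' z)) := by
    intro z
    induction z with
    | zero => simp
    | add x y hx hy => simp only [map_add, hx, hy]
    | tmul x y => simp [F, act]
  have h2 : ∀ (x : V) (w : B ⊗[k] B), F ((TensorProduct.assoc k V B B).symm (x ⊗ₜ w))
      = (TensorProduct.lid k k (TensorProduct.map ψ ψ' w)) • x := by
    intro x w
    induction w with
    | zero => simp
    | add a b ha hb => simp only [TensorProduct.tmul_add, map_add, ha, hb, add_smul]
    | tmul a b => simp [F, mul_smul, smul_comm (ψ a)]
  have h3 : ∀ z : V ⊗[k] B,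
      F ((TensorProduct.assoc k V B B).symm (LinearMap.lTensor V Coalgebra.comul z))
      = TensorProduct.rid k V (LinearMap.lTensor V ((TensorProduct.lid k k).toLinearMap ∘ₗ
        TensorProduct.map ψ ψ' ∘ₗ Coalgebra.comul) z) := by
    intro z
    induction z with
    | zero => simp
    | add x y hx hy => simp only [map_add, hx, hy]
    | tmul x y => rw [LinearMap.lTensor_tmul, h2]; simp
  have := congrArg F (c.coassoc v)
  rw [h1, h3] at this
  exact this

theorem rid_lTensor_rTensor (f : V →ₗ[k] V') (ψ : B →ₗ[k] k) (z : V ⊗[k] B) :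
    TensorProduct.rid k V' (LinearMap.lTensor V' ψ (LinearMap.rTensor B f z))
      = f (TensorProduct.rid k V (LinearMap.lTensor V ψ z)) := by
  induction z with
  | zero => simp
  | add x y hx hy => simp only [map_add, hx, hy]
  | tmul x y => simp

theorem assoc_symm_lTensor_rTensor (f : V →ₗ[k] V') (z : V ⊗[k] B) :
    (TensorProduct.assoc k V' B B).symm
        (LinearMap.lTensor V' Coalgebra.comul (LinearMap.rTensor B f z))
      = LinearMap.rTensor B (LinearMap.rTensor B f) ((TensorProduct.assoc k V B B).symm
        (LinearMap.lTensor V Coalgebra.comul z)) := by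
  induction z with
  | zero => simp
  | add x y hx hy => simp only [map_add, hx, hy]
  | tmul x y =>
    simp only [LinearMap.rTensor_tmul, LinearMap.lTensor_tmul]
    generalize (Coalgebra.comul y : B ⊗[k] B) = w
    induction w with
    | zero => simp
    | add a b ha hb => simp only [TensorProduct.tmul_add, map_add, ha, hb]
    | tmul a b => simp

theorem rTensor_comp_eq {f : V →ₗ[k] V'} {ρ : V →ₗ[k] V ⊗[k] B} {ρ' : V' →ₗ[k] V' ⊗[k] B}
    (h : ∀ v, LinearMap.rTensor B f (ρ v) = ρ' (f v)) (z : V ⊗[k] B) :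
    LinearMap.rTensor B ρ' (LinearMap.rTensor B f z)
      = LinearMap.rTensor B (LinearMap.rTensor B f) (LinearMap.rTensor B ρ z) := by
  rw [← LinearMap.comp_apply, ← LinearMap.comp_apply, ← LinearMap.rTensor_comp,
    ← LinearMap.rTensor_comp]
  congr 2
  ext v
  exact (h v).symm

/-- A linear map out of a comodule transports the coaction if it is surjective. -/
def ofSurjective (c : Coaction k B V) (f : V →ₗ[k] V') (hf : Function.Surjective f)
    (ρ' : V' →ₗ[k] V' ⊗[k] B) (h : ∀ v, LinearMap.rTensor B f (c.ρ v) = ρ' (f v)) :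
    Coaction k B V' where
  ρ := ρ'
  counit_law v := by
    obtain ⟨v, rfl⟩ := hf v
    rw [← h, rid_lTensor_rTensor, c.counit_law]
  coassoc v := by
    obtain ⟨v, rfl⟩ := hf v
    rw [← h, rTensor_comp_eq h, assoc_symm_lTensor_rTensor, c.coassoc]

/-- The coaction on the quotient by a subspace. -/
def quotient (c : Coaction k B V) (W : Submodule k V)
    (hW : ∀ w ∈ W, LinearMap.rTensor B W.mkQ (c.ρ w) = 0) : Coaction k B (V ⧸ W) :=
  c.ofSurjective W.mkQ W.mkQ_surjective (W.liftQ (LinearMap.rTensor B W.mkQ ∘ₗ c.ρ) hW)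
    fun _ => rfl

/-- The action of functionals on the quotient is induced. -/
theorem act_quotient (c : Coaction k B V) (W : Submodule k V)
    (hW : ∀ w ∈ W, LinearMap.rTensor B W.mkQ (c.ρ w) = 0) (ψ : B →ₗ[k] k) (v : V) :
    (c.quotient W hW).act ψ (W.mkQ v) = W.mkQ (c.act ψ v) :=
  rid_lTensor_rTensor W.mkQ ψ (c.ρ v)

end Ring

section Field

variable {k B V V' : Type} [Field k] [CommRing B] [Bialgebra k B]
  [AddCommGroup V] [Module k V] [AddCommGroup V'] [Module k V']

theorem rTensor_injective {f : V →ₗ[k] V'} (hf : Function.Injective f) (M : Type)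
    [AddCommGroup M] [Module k M] : Function.Injective (LinearMap.rTensor M f) :=
  Module.Flat.rTensor_preserves_injective_linearMap f hf

theorem rho_eq_tmul_one_iff (c : Coaction k B V) (v : V) :
    c.ρ v = v ⊗ₜ 1 ↔ ∀ ψ, c.act ψ v = ψ 1 • v := by
  refine ⟨fun h ψ => by simp [act, h], fun h => ?_⟩
  rw [← sub_eq_zero]
  refine TensorProduct.eq_zero_of_forall_lTensor _ fun ψ => ?_
  have := h ψ
  simp only [act, LinearMap.comp_apply, LinearEquiv.coe_coe] at this
  simp [this]

theorem Stable.rTensor_mkQ_eq_zero {c : Coaction k B V} {W : Submodule k V} (h : c.Stable W) :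
    ∀ w ∈ W, LinearMap.rTensor B W.mkQ (c.ρ w) = 0 := by
  intro w hw
  refine TensorProduct.eq_zero_of_forall_lTensor _ fun ψ => ?_
  rw [rid_lTensor_rTensor]
  exact (Submodule.Quotient.mk_eq_zero W).2 (h ψ w hw)

theorem Stable.mem_range {c : Coaction k B V} {W : Submodule k V} (h : c.Stable W)
    (w : W) : c.ρ w ∈ LinearMap.range (LinearMap.rTensor B W.subtype) := by
  have hex := rTensor_exact B (LinearMap.exact_subtype_mkQ W) W.mkQ_surjective
  exact (hex _).1 (h.rTensor_mkQ_eq_zero w w.2)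

/-- A linear injection into a comodule induces a coaction on its domain. -/
def ofInjective (c : Coaction k B V') (f : V →ₗ[k] V') (hf : Function.Injective f)
    (ρ : V →ₗ[k] V ⊗[k] B) (h : ∀ v, LinearMap.rTensor B f (ρ v) = c.ρ (f v)) :
    Coaction k B V where
  ρ := ρ
  counit_law v := by
    apply hf
    rw [← rid_lTensor_rTensor, h, c.counit_law]
  coassoc v := by
    apply rTensor_injective (rTensor_injective hf B) B
    rw [← rTensor_comp_eq h, ← assoc_symm_lTensor_rTensor, h, c.coassoc]

/-- A stable subspace carries a compatible coaction. -/
theorem Stable.exists_restrict {c : Coaction k B V} {W : Submodule k V} (h : c.Stable W) :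
    ∃ d : Coaction k B W, ∀ w, LinearMap.rTensor B W.subtype (d.ρ w) = c.ρ w := by
  obtain ⟨r, hr⟩ := W.subtype.exists_leftInverse_of_injective W.ker_subtype
  have key : ∀ w : W, LinearMap.rTensor B W.subtype
      ((LinearMap.rTensor B r ∘ₗ c.ρ ∘ₗ W.subtype) w) = c.ρ (W.subtype w) := by
    intro w
    obtain ⟨z, hz⟩ := h.mem_range w
    have hz' : c.ρ (W.subtype w) = LinearMap.rTensor B W.subtype z := hz.symm
    rw [LinearMap.comp_apply, LinearMap.comp_apply, hz']
    rw [← LinearMap.comp_apply (LinearMap.rTensor B r), ← LinearMap.rTensor_comp, hr]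
    simp
  exact ⟨c.ofInjective W.subtype W.injective_subtype _ key, key⟩

/-- The stable subspace generated by a vector. -/
def orbit (c : Coaction k B V) (v : V) : Submodule k V :=
  LinearMap.range ({ toFun := fun ψ => c.act ψ v
                     map_add' := by intros; simp [act, LinearMap.lTensor_add]
                     map_smul' := by intros; simp [act, LinearMap.lTensor_smul] } :
    (B →ₗ[k] k) →ₗ[k] V)

theorem mem_orbit (c : Coaction k B V) (v : V) : v ∈ c.orbit v := ⟨_, c.act_counit v⟩

theorem stable_orbit (c : Coaction k B V) (v : V) : c.Stable (c.orbit v) := by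
  rintro ψ _ ⟨ψ', rfl⟩
  exact ⟨_, (c.act_act ψ ψ' v).symm⟩

theorem orbit_le (c : Coaction k B V) (v : V) {W : Submodule k V} (hW : c.Stable W)
    (hv : v ∈ W) : c.orbit v ≤ W := by
  rintro _ ⟨ψ, rfl⟩
  exact hW ψ v hv

theorem finite_orbit (c : Coaction k B V) (v : V) : Module.Finite k (c.orbit v) := by
  have key : ∀ z : V ⊗[k] B, ∃ W : Submodule k V, W.FG ∧ ∀ ψ : B →ₗ[k] k,
      TensorProduct.rid k V (LinearMap.lTensor V ψ z) ∈ W := by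
    intro z
    induction z with
    | zero => exact ⟨⊥, Submodule.fg_bot, by simp⟩
    | add x y hx hy =>
      obtain ⟨W, h1, h2⟩ := hx
      obtain ⟨W', h1', h2'⟩ := hy
      refine ⟨W ⊔ W', h1.sup h1', fun ψ => ?_⟩
      rw [map_add, map_add]
      exact Submodule.add_mem_sup (h2 ψ) (h2' ψ)
    | tmul x y =>
      refine ⟨Submodule.span k {x}, Submodule.fg_span_singleton x, fun ψ => ?_⟩
      simp only [LinearMap.lTensor_tmul, TensorProduct.rid_tmul]
      exact Submodule.smul_mem _ _ (Submodule.mem_span_singleton_self x)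
  obtain ⟨W, h1, h2⟩ := key (c.ρ v)
  have : Module.Finite k W := Module.Finite.iff_fg.2 h1
  have hle : c.orbit v ≤ W := by
    rintro _ ⟨ψ, rfl⟩
    exact h2 ψ
  exact Submodule.finiteDimensional_of_le hle

theorem exists_fixed_of_stable {k B V : Type} [Field k] [CommRing B] [HopfAlgebra k B]
    [AddCommGroup V] [Module k V] (hB : IsUnipotentHopf k B)
    (c : Coaction k B V) {W : Submodule k V} (hW : c.Stable W) (hne : W ≠ ⊥) :
    ∃ v ∈ W, v ≠ 0 ∧ c.ρ v = v ⊗ₜ[k] (1 : B) := by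
  obtain ⟨x, hx, hx0⟩ := Submodule.exists_mem_ne_zero_of_ne_bot hne
  obtain ⟨d, hd⟩ := (c.stable_orbit x).exists_restrict
  have := c.finite_orbit x
  have : Nontrivial (c.orbit x) := ⟨⟨⟨x, c.mem_orbit x⟩, 0, fun h => hx0 (congrArg Subtype.val h)⟩⟩
  obtain ⟨v, hv0, hv⟩ := hB _ d this
  refine ⟨v, c.orbit_le x hW hx v.2, fun h => hv0 (Subtype.ext h), ?_⟩
  rw [← hd, hv]
  simp

end Field

end Coaction

section Points

open WithConv

variable {k A R R' : Type} [CommRing k] [CommRing A] [HopfAlgebra k A]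
    [CommRing R] [Algebra k R] [CommRing R'] [Algebra k R']

theorem ptMul_eq_ofConv (f g : A →ₐ[k] R) : ptMul f g = (toConv f * toConv g).ofConv := by
  rw [AlgHom.convMul_def]
  apply AlgHom.ext
  intro a
  simp only [ptMul, AlgHom.comp_apply]
  generalize (Bialgebra.comulAlgHom k A) a = z
  induction z with
  | zero => simp
  | add x y hx hy => simp only [map_add, hx, hy]
  | tmul x y => simp

/-- The inverse of a point of the affine group scheme `Spec A`. -/
def ptInv (g : A →ₐ[k] R) : A →ₐ[k] R := g.comp (HopfAlgebra.antipodeAlgHom k A)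

theorem ptOne_eq_ofConv : (ptOne R : A →ₐ[k] R) = (1 : WithConv (A →ₐ[k] R)).ofConv := rfl

theorem comp_ptOne (g : A →ₐ[k] R) : g.comp (ptOne A) = (ptOne R : A →ₐ[k] R) := by
  ext a
  exact g.commutes _

theorem toConv_ptInv_mul (g : A →ₐ[k] R) : toConv (ptInv g) * toConv g = 1 := by
  have := AlgHom.comp_convMul_distrib g
    (toConv (HopfAlgebra.antipodeAlgHom k A)) (toConv (AlgHom.id k A))
  rw [AlgHom.antipode_id_cancel, ← ptOne_eq_ofConv, comp_ptOne] at this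
  exact (congrArg toConv this).symm

theorem toConv_mul_ptInv (g : A →ₐ[k] R) : toConv g * toConv (ptInv g) = 1 := by
  have := AlgHom.comp_convMul_distrib g
    (toConv (AlgHom.id k A)) (toConv (HopfAlgebra.antipodeAlgHom k A))
  have h : toConv (AlgHom.id k A) * toConv (HopfAlgebra.antipodeAlgHom k A) = 1 :=
    mul_eq_one_comm.1 AlgHom.antipode_id_cancel
  rw [h, ← ptOne_eq_ofConv, comp_ptOne] at this
  exact (congrArg toConv this).symm

theorem ptMul_ptInv (g : A →ₐ[k] R) : ptMul g (ptInv g) = ptOne R := by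
  rw [ptMul_eq_ofConv, toConv_mul_ptInv, ptOne_eq_ofConv]

theorem ptInv_ptMul (g : A →ₐ[k] R) : ptMul (ptInv g) g = ptOne R := by
  rw [ptMul_eq_ofConv, toConv_ptInv_mul, ptOne_eq_ofConv]

theorem ptMul_ptOne (g : A →ₐ[k] R) : ptMul g (ptOne R) = g := by
  simp [ptMul_eq_ofConv, ptOne_eq_ofConv]

theorem ptOne_ptMul (g : A →ₐ[k] R) : ptMul (ptOne R) g = g := by
  simp [ptMul_eq_ofConv, ptOne_eq_ofConv]

theorem ptMul_assoc (f g h : A →ₐ[k] R) : ptMul (ptMul f g) h = ptMul f (ptMul g h) := by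
  simp [ptMul_eq_ofConv, mul_assoc]

theorem eq_ptOne_of_ptMul_self {f : A →ₐ[k] R} (h : ptMul f f = f) : f = ptOne R := by
  rw [← ptMul_ptInv f]
  nth_rewrite 2 [← h]
  rw [ptMul_assoc, ptMul_ptInv, ptMul_ptOne]

theorem ptMul_apply (f g : A →ₐ[k] R) (a : A) :
    ptMul f g a = Algebra.TensorProduct.productMap f g (Coalgebra.comul (R := k) a) := rfl

end Points

/-- A multiplicative matrix over a Hopf algebra, i.e. a matrix representation of the
affine group scheme `Spec A`. -/
structure IsMulMat (k : Type) {A ι : Type} [CommRing k] [CommRing A] [HopfAlgebra k A]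
    [Fintype ι] [DecidableEq ι] (c : Matrix ι ι A) : Prop where
  comul : ∀ i j, Coalgebra.comul (R := k) (c i j) = ∑ l, c i l ⊗ₜ[k] c l j
  counit : ∀ i j, Coalgebra.counit (R := k) (c i j) = (1 : Matrix ι ι k) i j

/-- The representation given by a multiplicative matrix has no proper nonzero
subrepresentation. -/
def IsSimpleMat (k : Type) {A ι : Type} [Field k] [CommRing A] [Algebra k A]
    [Fintype ι] (c : Matrix ι ι A) : Prop :=
  ∀ W : Submodule k (ι → k), (∀ ψ : A →ₗ[k] k, ∀ w ∈ W, (c.map ψ).mulVec w ∈ W) →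
    W = ⊥ ∨ W = ⊤

namespace IsMulMat

variable {k A R ι : Type} [CommRing k] [CommRing A] [HopfAlgebra k A]
    [CommRing R] [Algebra k R] [Fintype ι] [DecidableEq ι] {c : Matrix ι ι A}

theorem map_ptMul (hc : IsMulMat k c) (f g : A →ₐ[k] R) :
    c.map (ptMul f g) = c.map f * c.map g := by
  ext i j
  simp [ptMul_apply, hc.comul, Matrix.mul_apply]

theorem map_ptOne (hc : IsMulMat k c) : c.map (ptOne R : A →ₐ[k] R) = 1 := by
  ext i j
  have : (ptOne R : A →ₐ[k] R) (c i j) = algebraMap k R (Coalgebra.counit (R := k) (c i j)) := rfl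
  rw [Matrix.map_apply, this, hc.counit, Matrix.one_apply, Matrix.one_apply]
  split_ifs <;> simp

theorem map_mul_map_ptInv (hc : IsMulMat k c) (g : A →ₐ[k] R) :
    c.map g * c.map (ptInv g) = 1 := by
  rw [← hc.map_ptMul, ← hc.map_ptOne (R := R)]
  rw [ptMul_ptInv]

theorem map_eq_one_iff {m : Type} [DecidableEq m] {c : Matrix m m A} {f : A →ₐ[k] R} :
    c.map f = 1 ↔ ∀ i j, f (c i j - (1 : Matrix m m A) i j) = 0 := by
  have key : ∀ i j, f ((1 : Matrix m m A) i j) = (1 : Matrix m m R) i j := by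
    intro i j
    rw [Matrix.one_apply, Matrix.one_apply]
    split_ifs <;> simp
  rw [← Matrix.ext_iff]
  refine forall₂_congr fun i j => ?_
  rw [Matrix.map_apply, map_sub, key, sub_eq_zero]

end IsMulMat

section Kernel

variable (k A : Type) [Field k] [CommRing A] [HopfAlgebra k A]

/-- The ideal of the common kernel of all simple representations of `Spec A`. -/
def simpleIdeal : Ideal A :=
  Ideal.span {x | ∃ (n : ℕ) (c : Matrix (Fin n) (Fin n) A), IsMulMat k c ∧ IsSimpleMat k c ∧
    ∃ i j, x = c i j - (1 : Matrix (Fin n) (Fin n) A) i j}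

variable {k A}

theorem simpleIdeal_le_ker_iff {R : Type} [CommRing R] [Algebra k R] (f : A →ₐ[k] R) :
    simpleIdeal k A ≤ RingHom.ker f ↔ ∀ (n : ℕ) (c : Matrix (Fin n) (Fin n) A), IsMulMat k c →
      IsSimpleMat k c → c.map f = 1 := by
  rw [simpleIdeal, Ideal.span_le]
  constructor
  · intro h n c hc hs
    exact IsMulMat.map_eq_one_iff.2 fun i j => h ⟨n, c, hc, hs, i, j, rfl⟩
  · rintro h x ⟨n, c, hc, hs, i, j, rfl⟩
    exact IsMulMat.map_eq_one_iff.1 (h n c hc hs) i j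

theorem map_mk_simpleIdeal {n : ℕ} {c : Matrix (Fin n) (Fin n) A} (hc : IsMulMat k c)
    (hs : IsSimpleMat k c) : c.map (Ideal.Quotient.mkₐ k (simpleIdeal k A)) = 1 :=
  (simpleIdeal_le_ker_iff _).1 (Ideal.Quotient.mkₐ_ker k _).ge n c hc hs

instance : (simpleIdeal k A).IsHopfIdeal k where
  counit_eq_zero x hx := by
    refine (simpleIdeal_le_ker_iff (Bialgebra.counitAlgHom k A)).2 (fun n c hc hs => ?_) hx
    exact hc.map_ptOne (R := k)
  map_mkQ_comul_eq_zero x hx := by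
    let q := Ideal.Quotient.mkₐ k (simpleIdeal k A)
    let f := ptMul ((Algebra.TensorProduct.includeLeft (R := k) (S := k)
      (B := A ⧸ simpleIdeal k A)).comp q) ((Algebra.TensorProduct.includeRight (R := k)
        (A := A ⧸ simpleIdeal k A)).comp q)
    have hf : f x = 0 := by
      refine (simpleIdeal_le_ker_iff f).2 (fun n c hc hs => ?_) hx
      rw [hc.map_ptMul]
      have h := map_mk_simpleIdeal hc hs
      have h2 : ∀ {R : Type} [CommRing R] [Algebra k R] (g : A ⧸ simpleIdeal k A →ₐ[k] R),
          c.map (g.comp q) = 1 := by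
        intro R _ _ g
        have : c.map (g.comp q) = (c.map q).map g := rfl
        rw [this, h, Matrix.map_one _ (map_zero g) (map_one g)]
      rw [h2, h2, one_mul]
    have key : ∀ z : A ⊗[k] A, Algebra.TensorProduct.productMap
        ((Algebra.TensorProduct.includeLeft (R := k) (S := k)
          (B := A ⧸ simpleIdeal k A)).comp q) ((Algebra.TensorProduct.includeRight (R := k)
          (A := A ⧸ simpleIdeal k A)).comp q) z
        = TensorProduct.map q.toLinearMap q.toLinearMap z := by
      intro z
      induction z with
      | zero => simp
      | add x y hx hy => simp only [map_add, hx, hy]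
      | tmul x y => simp
    exact (key _).symm.trans hf
  antipode_mem x hx := by
    have h := (simpleIdeal_le_ker_iff (ptInv (Ideal.Quotient.mkₐ k (simpleIdeal k A)))).2
      (fun n c hc hs => ?_) hx
    · rw [← Ideal.Quotient.mkₐ_ker k (simpleIdeal k A)]
      exact h
    · rw [← hc.map_mul_map_ptInv (Ideal.Quotient.mkₐ k (simpleIdeal k A)),
        map_mk_simpleIdeal hc hs, one_mul]

variable (k A) in
/-- The common kernel of all simple representations, as a closed subgroup scheme. -/
def simpleKernel : ClosedSubgrp k A where
  B := A ⧸ simpleIdeal k A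
  π := Bialgebra.Quotient.mkBialgHom (simpleIdeal k A)
  surj := Ideal.Quotient.mk_surjective

theorem simpleKernel_mem_iff {R : Type} [CommRing R] [Algebra k R] (f : A →ₐ[k] R) :
    (simpleKernel k A).mem f ↔ ∀ (n : ℕ) (c : Matrix (Fin n) (Fin n) A), IsMulMat k c →
      IsSimpleMat k c → c.map f = 1 := by
  rw [← simpleIdeal_le_ker_iff]
  constructor
  · rintro ⟨g, rfl⟩ x hx
    have : Ideal.Quotient.mk (simpleIdeal k A) x = 0 := Ideal.Quotient.eq_zero_iff_mem.2 hx
    change g (Ideal.Quotient.mk (simpleIdeal k A) x) = 0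
    rw [this]
    exact map_zero g
  · intro h
    refine ⟨Ideal.Quotient.liftₐ (simpleIdeal k A) f h, ?_⟩
    ext a
    rfl

theorem simpleKernel_normal : (simpleKernel k A).Normal := by
  intro R _ _ f g hf
  refine ⟨ptMul (ptMul g f) (ptInv g), ?_, by
    rw [ptMul_assoc, ptInv_ptMul, ptMul_ptOne]⟩
  rw [simpleKernel_mem_iff] at hf ⊢
  intro n c hc hs
  rw [hc.map_ptMul, hc.map_ptMul, hf n c hc hs, mul_one, hc.map_mul_map_ptInv]

end Kernel

theorem TensorProduct.ext_functional {k B : Type} [Field k] [AddCommGroup B] [Module k B]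
    {z z' : B ⊗[k] B} (h : ∀ ψ ψ' : B →ₗ[k] k,
      TensorProduct.lid k k (TensorProduct.map ψ ψ' z) =
        TensorProduct.lid k k (TensorProduct.map ψ ψ' z')) : z = z' := by
  have key : ∀ (ψ ψ' : B →ₗ[k] k) (z : B ⊗[k] B), ψ (TensorProduct.rid k B
      (LinearMap.lTensor B ψ' z)) = TensorProduct.lid k k (TensorProduct.map ψ ψ' z) := by
    intro ψ ψ' z
    induction z with
    | zero => simp
    | add x y hx hy => simp only [map_add, hx, hy]
    | tmul x y => simp [mul_comm (ψ x)]
  rw [← sub_eq_zero]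
  refine TensorProduct.eq_zero_of_forall_lTensor _ fun ψ' => ?_
  rw [← Module.forall_dual_apply_eq_zero_iff k]
  intro ψ
  rw [key, map_sub, map_sub, h, sub_self]

namespace Coaction

variable {k A V V' : Type} [Field k] [CommRing A] [AddCommGroup V] [Module k V]
  [AddCommGroup V'] [Module k V']

section Bialgebra

variable [Bialgebra k A]

theorem act_sum_smul (c : Coaction k A V) {ι : Type} [Fintype ι] (b : Module.Basis ι k V)
    (ψ : A →ₗ[k] k) (v : V) (i : ι) :
    b.repr (c.act ψ v) i = ∑ j, b.repr v j * ψ (c.coef (b.coord i) (b j)) := by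
  conv_lhs => rw [← b.sum_repr v, map_sum]
  simp [apply_coef, Finsupp.finsetSum_apply, -Module.Basis.sum_repr]

theorem coef_act (c : Coaction k A V) (φ : V →ₗ[k] k) (ψ : A →ₗ[k] k) (v : V) :
    c.coef φ (c.act ψ v) =
      TensorProduct.rid k A (LinearMap.lTensor A ψ (Coalgebra.comul (R := k) (c.coef φ v))) := by
  rw [← sub_eq_zero, ← Module.forall_dual_apply_eq_zero_iff k]
  intro ψ'
  have key : ∀ z : A ⊗[k] A, ψ' (TensorProduct.rid k A
      (LinearMap.lTensor A ψ z)) = TensorProduct.lid k k (TensorProduct.map ψ' ψ z) := by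
    intro z
    induction z with
    | zero => simp
    | add x y hx hy => simp only [map_add, hx, hy]
    | tmul x y => simp [mul_comm (ψ' x)]
  rw [map_sub, apply_coef, act_act, ← apply_coef, key, sub_eq_zero]
  rfl

theorem Stable.sup {c : Coaction k A V} {W W' : Submodule k V} (h : c.Stable W)
    (h' : c.Stable W') : c.Stable (W ⊔ W') := by
  intro ψ w hw
  obtain ⟨x, hx, y, hy, rfl⟩ := Submodule.mem_sup.1 hw
  rw [map_add]
  exact Submodule.add_mem_sup (h ψ x hx) (h' ψ y hy)

theorem exists_stable_finite_ge (c : Coaction k A V) {W₀ : Submodule k V} (h : W₀.FG) :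
    ∃ W, W₀ ≤ W ∧ c.Stable W ∧ Module.Finite k W := by
  induction W₀, h using Submodule.fg_induction with
  | singleton x =>
    exact ⟨c.orbit x, (Submodule.span_singleton_le_iff_mem _ _).2 (c.mem_orbit x),
      c.stable_orbit x, c.finite_orbit x⟩
  | sup M₁ M₂ h₁ h₂ h₁' h₂' =>
    obtain ⟨W, h1, h2, h3⟩ := h₁'
    obtain ⟨W', h1', h2', h3'⟩ := h₂'
    exact ⟨W ⊔ W', sup_le_sup h1 h1', h2.sup h2', inferInstance⟩

variable (k A) in
/-- The regular representation. -/
def regular : Coaction k A A where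
  ρ := Coalgebra.comul
  counit_law v := by simp
  coassoc v := by
    rw [LinearEquiv.eq_symm_apply, Coalgebra.coassoc_apply]

end Bialgebra

variable [HopfAlgebra k A]

theorem isMulMat_coef (c : Coaction k A V) {ι : Type} [Fintype ι] [DecidableEq ι]
    (b : Module.Basis ι k V) :
    IsMulMat k (Matrix.of fun i j => c.coef (b.coord i) (b j)) where
  comul i j := by
    apply TensorProduct.ext_functional
    intro ψ ψ'
    have h := c.apply_coef (b.coord i) ((TensorProduct.lid k k).toLinearMap ∘ₗ
      TensorProduct.map ψ ψ' ∘ₗ Coalgebra.comul) (b j)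
    rw [← act_act, Module.Basis.coord_apply, act_sum_smul] at h
    refine h.trans ?_
    simp [apply_coef, mul_comm]
  counit i j := by
    rw [Matrix.of_apply, apply_coef, act_counit, Module.Basis.coord_apply, b.repr_self,
      Finsupp.single_apply, Matrix.one_apply]
    simp only [eq_comm]

theorem isSimpleMat_coef (c : Coaction k A V) (hc : ∀ W, c.Stable W → W = ⊥ ∨ W = ⊤)
    {ι : Type} [Fintype ι] (b : Module.Basis ι k V) :
    IsSimpleMat k (Matrix.of fun i j => c.coef (b.coord i) (b j)) := by
  intro W hW
  have h := hc (W.comap b.equivFun.toLinearMap) ?_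
  · have hs : Function.Surjective b.equivFun.toLinearMap := b.equivFun.surjective
    refine h.imp (fun h => ?_) fun h => ?_
    · rw [← Submodule.map_comap_eq_of_surjective hs W, h, Submodule.map_bot]
    · rw [← Submodule.map_comap_eq_of_surjective hs W, h, Submodule.map_top,
        LinearMap.range_eq_top.2 hs]
  · intro ψ v hv
    rw [Submodule.mem_comap] at hv ⊢
    have := hW ψ _ hv
    convert this using 1
    ext i
    simp [act_sum_smul, Matrix.mulVec, dotProduct, mul_comm]

theorem act_eq_smul_of_simple [Module.Finite k V] (c : Coaction k A V)
    (hc : ∀ W, c.Stable W → W = ⊥ ∨ W = ⊤) (ψ : A ⧸ simpleIdeal k A →ₗ[k] k) (v : V) :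
    c.act (ψ ∘ₗ (Ideal.Quotient.mkₐ k (simpleIdeal k A)).toLinearMap) v = ψ 1 • v := by
  let b := Module.finBasis k V
  have h := map_mk_simpleIdeal (c.isMulMat_coef b) (c.isSimpleMat_coef hc b)
  apply b.repr.injective
  ext i
  have h' : ∀ j, Ideal.Quotient.mkₐ k (simpleIdeal k A) (c.coef (b.coord i) (b j))
      = (1 : Matrix _ _ (A ⧸ simpleIdeal k A)) i j := fun j => congrFun₂ h i j
  simp only [act_sum_smul, LinearMap.comp_apply, AlgHom.toLinearMap_apply, h', map_smul,
    Finsupp.smul_apply, smul_eq_mul]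
  rw [Finset.sum_eq_single i]
  · simp [mul_comm]
  · intro j _ hj
    simp [Matrix.one_apply_ne hj.symm]
  · simp

theorem exists_stable_act_sub_mem [Module.Finite k V] [Nontrivial V] (c : Coaction k A V) :
    ∃ Z, c.Stable Z ∧ Z ≠ ⊤ ∧ ∀ (ψ : A ⧸ simpleIdeal k A →ₗ[k] k) v,
      c.act (ψ ∘ₗ (Ideal.Quotient.mkₐ k (simpleIdeal k A)).toLinearMap) v - ψ 1 • v ∈ Z := by
  obtain ⟨Z, ⟨hZ, hZ'⟩, hmax⟩ := WellFounded.has_min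
    (r := ((· > ·) : Submodule k V → Submodule k V → Prop)) wellFounded_gt
    {Z | c.Stable Z ∧ Z ≠ ⊤} ⟨⊥, by
      refine ⟨fun ψ w hw => ?_, bot_ne_top⟩
      rw [(Submodule.mem_bot k).1 hw, map_zero]
      exact zero_mem _⟩
  refine ⟨Z, hZ, hZ', fun ψ v => ?_⟩
  rw [← Submodule.Quotient.mk_eq_zero, ← Submodule.mkQ_apply, map_sub,
    ← c.act_quotient Z hZ.rTensor_mkQ_eq_zero, act_eq_smul_of_simple, map_smul, sub_self]
  intro Y hY
  have hst : c.Stable (Y.comap Z.mkQ) := by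
    intro ψ w hw
    rw [Submodule.mem_comap, ← c.act_quotient Z hZ.rTensor_mkQ_eq_zero]
    exact hY ψ _ hw
  have hle : Z ≤ Y.comap Z.mkQ := fun z hz => by
    rw [Submodule.mem_comap, Submodule.mkQ_apply, (Submodule.Quotient.mk_eq_zero Z).2 hz]
    exact zero_mem _
  rw [← Submodule.map_comap_eq_of_surjective Z.mkQ_surjective Y]
  by_cases ht : Y.comap Z.mkQ = ⊤
  · right
    rw [ht, Submodule.map_top, Submodule.range_mkQ]
  · left
    have : Y.comap Z.mkQ = Z := by
      by_contra hne
      exact hmax _ ⟨hst, ht⟩ (lt_of_le_of_ne hle (Ne.symm hne))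
    rw [this, Submodule.mkQ_map_self]

end Coaction

theorem isUnipotentHopf_simpleKernel (k A : Type) [Field k] [CommRing A] [HopfAlgebra k A] :
    IsUnipotentHopf k (A ⧸ simpleIdeal k A) := by
  intro X _ _ _ c _
  let q := (Ideal.Quotient.mkₐ k (simpleIdeal k A)).toLinearMap
  have hq : Function.Surjective q := Ideal.Quotient.mk_surjective
  let cf : X → (X →ₗ[k] k) →ₗ[k] A ⧸ simpleIdeal k A := fun x =>
    { toFun := fun φ => c.coef φ x
      map_add' := by intros; simp [Coaction.coef, LinearMap.rTensor_add]
      map_smul' := by intros; simp [Coaction.coef, LinearMap.rTensor_smul] }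
  let P : ℕ → Prop := fun n => ∃ W : Submodule k A, (Coaction.regular k A).Stable W ∧
    Module.Finite k W ∧ Module.finrank k W = n ∧ ∃ x ≠ 0, ∀ φ, c.coef φ x ∈ W.map q
  have hP : ∃ n, P n := by
    obtain ⟨x, hx⟩ := exists_ne (0 : X)
    obtain ⟨σ, hσ⟩ := q.exists_rightInverse_of_surjective (LinearMap.range_eq_top.2 hq)
    obtain ⟨W, h1, h2, h3⟩ := (Coaction.regular k A).exists_stable_finite_ge
      (W₀ := (LinearMap.range (cf x)).map σ)
      ((Module.Finite.iff_fg.1 inferInstance : (LinearMap.range (cf x)).FG).map σ)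
    refine ⟨_, W, h2, h3, rfl, x, hx, fun φ => ?_⟩
    exact ⟨σ (c.coef φ x), h1 ⟨_, ⟨φ, rfl⟩, rfl⟩, LinearMap.congr_fun hσ _⟩
  classical
  obtain ⟨W, hW, hWf, hWn, x, hx, hxW⟩ := Nat.find_spec hP
  have hmin := fun m => Nat.find_min hP (m := m)
  rw [← hWn] at hmin
  have hW0 : Nontrivial W := by
    rw [Submodule.nontrivial_iff_ne_bot]
    rintro rfl
    apply hx
    rw [← Module.forall_dual_apply_eq_zero_iff k]
    intro φ
    have := hxW φ
    rw [Submodule.map_bot, Submodule.mem_bot] at this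
    rw [← c.act_counit x, ← c.apply_coef, this, map_zero]
  obtain ⟨d, hd⟩ := hW.exists_restrict
  have hact : ∀ ψ w, W.subtype (d.act ψ w) = (Coaction.regular k A).act ψ w := by
    intro ψ w
    refine (Coaction.rid_lTensor_rTensor W.subtype ψ (d.ρ w)).symm.trans ?_
    rw [hd]
    rfl
  obtain ⟨Z, hZ, hZt, hZm⟩ := d.exists_stable_act_sub_mem
  have hlt : Module.finrank k (Z.map W.subtype) < Module.finrank k W := by
    rw [LinearEquiv.finrank_eq (Z.equivMapOfInjective _ W.injective_subtype).symm]
    exact Submodule.finrank_lt hZt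
  have hZst : (Coaction.regular k A).Stable (Z.map W.subtype) := by
    rintro ψ _ ⟨z, hz, rfl⟩
    exact ⟨_, hZ ψ z hz, hact ψ z⟩
  refine ⟨x, hx, (c.rho_eq_tmul_one_iff x).2 fun ψ => ?_⟩
  by_contra hne
  refine hmin _ hlt ⟨_, hZst, inferInstance, rfl, _, sub_ne_zero.2 hne, fun φ => ?_⟩
  obtain ⟨w, hw, hwx⟩ := hxW φ
  refine ⟨_, ⟨_, hZm ψ ⟨w, hw⟩, rfl⟩, ?_⟩
  rw [map_sub, hact, map_sub, map_sub, Coaction.coef_act, ← hwx]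
  have key : ∀ z : A ⊗[k] A, q (TensorProduct.rid k A (LinearMap.lTensor A (ψ ∘ₗ q) z)) =
      TensorProduct.rid k _ (LinearMap.lTensor _ ψ (TensorProduct.map q q z)) := by
    intro z
    induction z with
    | zero => simp
    | add x y hx hy => simp only [map_add, hx, hy]
    | tmul x y => simp
  congr 1
  · exact key _
  · rw [map_smul, map_smul, map_smul, ← hwx]
    rfl

section BaseChange

variable {k K A A' : Type} [Field k] [Field K] [Algebra k K] [CommRing A] [HopfAlgebra k A]
  [CommRing A'] [HopfAlgebra K A'] [Algebra k A'] [IsScalarTower k K A']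

variable (K) in
/-- The map `u : A → A'` exhibits the Hopf algebra `A'` as the base change of `A` along
`k → K`. -/
structure IsHopfBaseChange (u : A →ₐ[k] A') : Prop where
  base : IsBaseChange K u.toLinearMap
  mul : ∀ {R : Type} [CommRing R] [Algebra k R] [Algebra K R] [IsScalarTower k K R]
    (f g : A' →ₐ[K] R), ((ptMul f g).restrictScalars k).comp u =
      ptMul ((f.restrictScalars k).comp u) ((g.restrictScalars k).comp u)
  lift : ∀ {R : Type} [CommRing R] [Algebra k R] [Algebra K R] [IsScalarTower k K R]
    (g : A →ₐ[k] R), ∃ f : A' →ₐ[K] R, (f.restrictScalars k).comp u = g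

theorem BaseChangePresentation.exists_isHopfBaseChange (P : BaseChangePresentation k K A A') :
    ∃ u : A →ₐ[k] A', IsHopfBaseChange K u ∧
      ∀ (R : Type) (iR : CommRing R) (ik : Algebra k R)
      (iK : Algebra K R) (it : IsScalarTower k K R) (f : A' →ₐ[K] R),
      P.e R iR ik iK it f = (f.restrictScalars k).comp u := by
  let u : A →ₐ[k] A' := P.e A' inferInstance inferInstance inferInstance inferInstance
    (AlgHom.id K A')
  have hu : ∀ (R : Type) (iR : CommRing R) (ik : Algebra k R)
      (iK : Algebra K R) (it : IsScalarTower k K R) (f : A' →ₐ[K] R),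
      P.e R iR ik iK it f = (f.restrictScalars k).comp u := fun R iR ik iK it f =>
    P.natural A' R _ _ _ _ iR ik iK it f (AlgHom.id K A')
  refine ⟨u, ⟨?_, fun f g => ?_, fun g => ?_⟩, hu⟩
  · let E : K ⊗[k] A →ₐ[K] A' :=
      Algebra.TensorProduct.lift (Algebra.ofId K A') u fun _ _ => Commute.all _ _
    have hE : ∀ a, E (1 ⊗ₜ a) = u a := fun a => by simp [E]
    obtain ⟨θ, hθ⟩ := (P.bij (K ⊗[k] A) inferInstance inferInstance inferInstance
      inferInstance).2 Algebra.TensorProduct.includeRight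
    rw [hu] at hθ
    have hθ' : ∀ a, θ (u a) = 1 ⊗ₜ a := fun a => AlgHom.congr_fun hθ a
    have h1 : θ.comp E = AlgHom.id K _ := by
      apply Algebra.TensorProduct.ext'
      intro a b
      have : a ⊗ₜ[k] b = a • ((1 : K) ⊗ₜ[k] b) := by simp [TensorProduct.smul_tmul']
      rw [AlgHom.comp_apply, this, map_smul, map_smul, hE, hθ']
      rfl
    have h2 : E.comp θ = AlgHom.id K _ := by
      apply (P.bij A' inferInstance inferInstance inferInstance inferInstance).1
      rw [hu, hu]
      ext a
      simp only [AlgHom.comp_apply, AlgHom.restrictScalars_apply, hθ', hE, AlgHom.id_apply]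
    exact IsBaseChange.of_equiv (AlgEquiv.ofAlgHom E θ h2 h1).toLinearEquiv hE
  · rw [← hu, ← hu, ← hu]
    exact P.mul _ _ _ _ _ f g
  · obtain ⟨f, hf⟩ := (P.bij _ inferInstance inferInstance inferInstance inferInstance).2 g
    exact ⟨f, (hu _ _ _ _ _ f).symm.trans hf⟩

namespace IsHopfBaseChange

variable {u : A →ₐ[k] A'}

theorem restrict_ptOne (hu : IsHopfBaseChange K u)
    {R : Type} [CommRing R] [Algebra k R] [Algebra K R] [IsScalarTower k K R] :
    ((ptOne R : A' →ₐ[K] R).restrictScalars k).comp u = ptOne R := by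
  apply eq_ptOne_of_ptMul_self
  rw [← hu.mul, ptMul_ptOne]

theorem counit_apply (hu : IsHopfBaseChange K u) (a : A) :
    Coalgebra.counit (R := K) (u a) = algebraMap k K (Coalgebra.counit (R := k) a) :=
  AlgHom.congr_fun (hu.restrict_ptOne (R := K)) a

theorem comul_apply (hu : IsHopfBaseChange K u) (a : A) : Coalgebra.comul (R := K) (u a) =
    Algebra.TensorProduct.productMap
      (((Algebra.TensorProduct.includeLeft : A' →ₐ[K] A' ⊗[K] A').restrictScalars k).comp u)
      (((Algebra.TensorProduct.includeRight : A' →ₐ[K] A' ⊗[K] A').restrictScalars k).comp u)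
      (Coalgebra.comul (R := k) a) := by
  have h := AlgHom.congr_fun (hu.mul (R := A' ⊗[K] A') Algebra.TensorProduct.includeLeft
    Algebra.TensorProduct.includeRight) a
  rw [AlgHom.comp_apply, AlgHom.restrictScalars_apply, ptMul_apply, ptMul_apply] at h
  have key : Algebra.TensorProduct.productMap (Algebra.TensorProduct.includeLeft :
      A' →ₐ[K] A' ⊗[K] A') Algebra.TensorProduct.includeRight = AlgHom.id K _ :=
    Algebra.TensorProduct.ext' fun a b => by simp
  rw [key] at h
  exact h

theorem isMulMat (hu : IsHopfBaseChange K u)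
    {ι : Type} [Fintype ι] [DecidableEq ι] {c : Matrix ι ι A} (hc : IsMulMat k c) :
    IsMulMat K (c.map u) where
  comul i j := by
    simp [hu.comul_apply, hc.comul]
  counit i j := by
    rw [Matrix.map_apply, hu.counit_apply, hc.counit, Matrix.one_apply, Matrix.one_apply]
    split_ifs <;> simp

end IsHopfBaseChange

end BaseChange

section Descent

variable {k K B X : Type} [Field k] [Field K] [Algebra k K] [CommRing B] [HopfAlgebra k B]
  [AddCommGroup X] [Module k X] [Module K X] [IsScalarTower k K X]

open TensorProduct.AlgebraTensorModule in
/-- A comodule over the base change `K ⊗ B` is a comodule over `B` by restriction of scalars. -/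
def Coaction.restrictBase (c : Coaction K (K ⊗[k] B) X) : Coaction k B X where
  ρ := ((cancelBaseChange k K K X B).toLinearMap ∘ₗ c.ρ).restrictScalars k
  counit_law v := by
    have key : ∀ z : X ⊗[K] (K ⊗[k] B),
        TensorProduct.rid k X (LinearMap.lTensor X (Coalgebra.counit (R := k) (A := B))
          (cancelBaseChange k K K X B z)) =
        TensorProduct.rid K X (LinearMap.lTensor X Coalgebra.counit z) := by
      intro z
      induction z with
      | zero => simp
      | add x y hx hy => simp only [map_add, hx, hy]
      | tmul x y =>
        induction y with
        | zero => simp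
        | add y y' hx hy => simp only [TensorProduct.tmul_add, map_add, hx, hy]
        | tmul a b =>
          simp [TensorProduct.counit_tmul]
          rw [TensorProduct.smul_tmul', TensorProduct.rid_tmul, smul_comm]
    exact (key _).trans (c.counit_law v)
  coassoc v := by
    let e := cancelBaseChange k K K X B
    let E : (X ⊗[K] (K ⊗[k] B)) ⊗[K] (K ⊗[k] B) →ₗ[k] (X ⊗[k] B) ⊗[k] B :=
      LinearMap.rTensor B (e.toLinearMap.restrictScalars k) ∘ₗ
        (cancelBaseChange k K K (X ⊗[K] (K ⊗[k] B)) B).toLinearMap.restrictScalars k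
    have h1 : ∀ z, E (LinearMap.rTensor (K ⊗[k] B) c.ρ z) = LinearMap.rTensor B
        ((e.toLinearMap ∘ₗ c.ρ).restrictScalars k) (e z) := by
      intro z
      induction z with
      | zero => simp
      | add x y hx hy => simp only [map_add, hx, hy]
      | tmul x y =>
        induction y with
        | zero => simp
        | add y y' hx hy => simp only [TensorProduct.tmul_add, map_add, hx, hy]
        | tmul a b => simp [E, e]
    have h2 : ∀ z, E ((TensorProduct.assoc K X (K ⊗[k] B) (K ⊗[k] B)).symm
        (LinearMap.lTensor X Coalgebra.comul z)) =
        (TensorProduct.assoc k X B B).symm (LinearMap.lTensor X Coalgebra.comul (e z)) := by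
      intro z
      induction z with
      | zero => simp
      | add x y hx hy => simp only [map_add, hx, hy]
      | tmul x y =>
        induction y with
        | zero => simp
        | add y y' hx hy => simp only [TensorProduct.tmul_add, map_add, hx, hy]
        | tmul a b =>
          simp only [e, LinearMap.lTensor_tmul, cancelBaseChange_tmul, TensorProduct.comul_tmul,
            CommSemiring.comul_apply]
          generalize (Coalgebra.comul b : B ⊗[k] B) = w
          induction w with
          | zero => simp
          | add y y' hx hy => simp only [TensorProduct.tmul_add, map_add, hx, hy]
          | tmul b b' => simp [E, e, TensorProduct.smul_tmul']
    have := congrArg E (c.coassoc v)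
    rw [h1, h2] at this
    exact this

theorem IsUnipotentHopf.baseChange (K : Type) [Field K] [Algebra k K]
    (hB : IsUnipotentHopf k B) : IsUnipotentHopf K (K ⊗[k] B) := by
  intro X _ _ _ c _
  let _ : Module k X := Module.compHom X (algebraMap k K)
  have : IsScalarTower k K X := ⟨fun a b x => by
    rw [Algebra.smul_def, mul_smul]
    rfl⟩
  obtain ⟨v, -, hv0, hv⟩ := c.restrictBase.exists_fixed_of_stable hB
    (W := ⊤) (fun _ _ _ => trivial) top_ne_bot
  refine ⟨v, hv0, ?_⟩
  apply (TensorProduct.AlgebraTensorModule.cancelBaseChange k K K X B).injective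
  refine hv.trans ?_
  rw [Algebra.TensorProduct.one_def, TensorProduct.AlgebraTensorModule.cancelBaseChange_tmul,
    one_smul]

end Descent

section BaseChangeSubgroup

variable {k K A A' : Type} [Field k] [Field K] [Algebra k K] [CommRing A] [HopfAlgebra k A]
  [CommRing A'] [HopfAlgebra K A'] [Algebra k A'] [IsScalarTower k K A']
  {u : A →ₐ[k] A'}

theorem IsHopfBaseChange.algHom_ext (hu : IsHopfBaseChange K u) {R : Type} [Semiring R]
    [Algebra K R] {f g : A' →ₐ[K] R} (h : ∀ a, f (u a) = g (u a)) : f = g :=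
  AlgHom.toLinearMap_injective (hu.base.algHom_ext _ _ h)

/-- The base change of a closed subgroup scheme. -/
theorem IsHopfBaseChange.exists_baseChange (hu : IsHopfBaseChange K u) (U : ClosedSubgrp k A) :
    ∃ H : ClosedSubgrp K A', (IsUnipotentHopf k U.B → IsUnipotentHopf K H.B) ∧
      ∀ {R : Type} [CommRing R] [Algebra k R] [Algebra K R] [IsScalarTower k K R]
        (f : A' →ₐ[K] R), H.mem f ↔ U.mem ((f.restrictScalars k).comp u) := by
  obtain ⟨p, hp⟩ := hu.lift ((Algebra.TensorProduct.includeRight : U.B →ₐ[k] K ⊗[k] U.B).comp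
    (U.π : A →ₐ[k] U.B))
  have hp' : ∀ a, p (u a) = 1 ⊗ₜ U.π a := fun a => AlgHom.congr_fun hp a
  let π : A' →ₐc[K] K ⊗[k] U.B := BialgHom.ofAlgHom p
    (by
      apply hu.algHom_ext
      intro a
      have h1 : Coalgebra.counit (R := k) (U.π a) = Coalgebra.counit (R := k) a :=
        CoalgHomClass.counit_comp_apply U.π a
      simp [hp', hu.counit_apply, TensorProduct.counit_tmul, h1, Algebra.algebraMap_eq_smul_one])
    (by
      apply hu.algHom_ext
      intro a
      have h1 := CoalgHomClass.map_comp_comul_apply U.π a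
      simp only [AlgHom.comp_apply, Bialgebra.comulAlgHom_apply, hp', hu.comul_apply,
        TensorProduct.comul_tmul, CommSemiring.comul_apply, ← h1]
      generalize (Coalgebra.comul a : A ⊗[k] A) = w
      induction w with
      | zero => simp
      | add y y' hx hy => simp only [TensorProduct.tmul_add, map_add, hx, hy]
      | tmul b b' => simp [hp'])
  have hπ : ∀ x, π x = p x := fun _ => rfl
  have hsurj : Function.Surjective π := by
    intro z
    induction z with
    | zero => exact ⟨0, map_zero π⟩
    | add x y hx hy =>
      obtain ⟨x, rfl⟩ := hx
      obtain ⟨y, rfl⟩ := hy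
      exact ⟨x + y, map_add π x y⟩
    | tmul a b =>
      obtain ⟨b, rfl⟩ := U.surj b
      refine ⟨a • u b, ?_⟩
      rw [hπ, map_smul, hp', TensorProduct.smul_tmul', smul_eq_mul, mul_one]
  refine ⟨⟨K ⊗[k] U.B, π, hsurj⟩, fun h => h.baseChange K, fun {R} _ _ _ _ f => ⟨?_, ?_⟩⟩
  · rintro ⟨g, rfl⟩
    refine ⟨(g.restrictScalars k).comp Algebra.TensorProduct.includeRight, ?_⟩
    ext a
    exact congrArg g (hp' a)
  · rintro ⟨g, hg⟩
    refine ⟨Algebra.TensorProduct.lift (Algebra.ofId K R) g fun _ _ => Commute.all _ _, ?_⟩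
    apply hu.algHom_ext
    intro a
    have h1 : f (u a) = g (U.π a) := AlgHom.congr_fun hg a
    have h2 : (π : A' →ₐ[K] K ⊗[k] U.B) (u a) = 1 ⊗ₜ U.π a := hp' a
    rw [AlgHom.comp_apply]
    refine h1.trans (.trans ?_ (congrArg _ h2).symm)
    simp

theorem IsHopfBaseChange.normal_of_mem_iff (hu : IsHopfBaseChange K u) {U : ClosedSubgrp k A}
    (hU : U.Normal) {H : ClosedSubgrp K A'}
    (hH : ∀ {R : Type} [CommRing R] [Algebra k R] [Algebra K R] [IsScalarTower k K R]
        (f : A' →ₐ[K] R), H.mem f ↔ U.mem ((f.restrictScalars k).comp u)) : H.Normal := by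
  intro R _ _ f g hf
  let _ : Algebra k R := Algebra.compHom R (algebraMap k K)
  have : IsScalarTower k K R := IsScalarTower.of_algebraMap_eq fun _ => rfl
  obtain ⟨f', hf', h⟩ := hU R _ ((g.restrictScalars k).comp u) ((hH f).1 hf)
  obtain ⟨f', rfl⟩ := hu.lift f'
  refine ⟨f', (hH f').2 hf', hu.algHom_ext fun a => ?_⟩
  rw [← hu.mul, ← hu.mul] at h
  exact AlgHom.congr_fun h a

end BaseChangeSubgroup

namespace IsMulMat

section

variable {k B ι : Type} [CommRing k] [CommRing B] [HopfAlgebra k B] [Fintype ι] [DecidableEq ι]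
  {d : Matrix ι ι B}

/-- The comodule attached to a multiplicative matrix. -/
def coaction (hd : IsMulMat k d) : Coaction k B (ι → k) where
  ρ := ∑ j, ∑ i, (TensorProduct.mk k (ι → k) B).flip (d i j) ∘ₗ
    LinearMap.single k (fun _ => k) i ∘ₗ LinearMap.proj j
  counit_law v := by
    ext i
    simp [hd.counit, Matrix.one_apply]
  coassoc v := by
    have key : ∀ i (x : k), ∑ j, ∑ i', (Pi.single i' ((Pi.single i x : ι → k) j) : ι → k) ⊗ₜ[k]
        d i' j = ∑ i', (Pi.single i' x : ι → k) ⊗ₜ[k] d i' i := by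
      intro i x
      rw [Finset.sum_eq_single i]
      · simp
      · intro j _ hj
        simp [Pi.single_eq_of_ne hj]
      · simp
    simp only [LinearMap.sum_apply, LinearMap.comp_apply, LinearMap.flip_apply,
      TensorProduct.mk_apply, LinearMap.proj_apply, LinearMap.single_apply, map_sum,
      LinearMap.rTensor_tmul, LinearMap.lTensor_tmul, key, hd.comul, TensorProduct.tmul_sum,
      TensorProduct.sum_tmul, TensorProduct.assoc_symm_tmul]
    refine Finset.sum_congr rfl fun j _ => Finset.sum_comm

theorem act_coaction (hd : IsMulMat k d) (ψ : B →ₗ[k] k) (v : ι → k) :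
    hd.coaction.act ψ v = (d.map ψ).mulVec v := by
  ext i
  simp [coaction, Coaction.act, Matrix.mulVec, dotProduct, Pi.single_apply]

end

variable {k A ι : Type} [Field k] [CommRing A] [HopfAlgebra k A]
  [Fintype ι] [DecidableEq ι] {c : Matrix ι ι A}

theorem map_bialgHom {B : Type} [CommRing B] [HopfAlgebra k B] (hc : IsMulMat k c)
    (π : A →ₐc[k] B) : IsMulMat k (c.map π) where
  comul i j := by
    rw [Matrix.map_apply, ← CoalgHomClass.map_comp_comul_apply, hc.comul]
    simp
  counit i j := by
    rw [Matrix.map_apply, CoalgHomClass.counit_comp_apply, hc.counit]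

/-- The vectors fixed by a closed subgroup scheme in a matrix representation. -/
def fixed (c : Matrix ι ι A) (H : ClosedSubgrp k A) : Submodule k (ι → k) where
  carrier := {x | ∀ i, ∑ j, x j • H.π (c i j) = x i • 1}
  zero_mem' := by simp
  add_mem' hx hy i := by
    simp only [Pi.add_apply, add_smul, Finset.sum_add_distrib]
    rw [hx, hy]
  smul_mem' a x hx i := by
    simp only [Pi.smul_apply, smul_assoc, ← Finset.smul_sum]
    rw [hx]

theorem mem_fixed {m : Type} [Fintype m] {c : Matrix m m A} {H : ClosedSubgrp k A} {x : m → k} :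
    x ∈ fixed c H ↔ ∀ i, ∑ j, x j • H.π (c i j) = x i • 1 := Iff.rfl

theorem mem_fixed_iff (hc : IsMulMat k c) {H : ClosedSubgrp k A} {x : ι → k} :
    x ∈ fixed c H ↔ (hc.map_bialgHom H.π).coaction.ρ x = x ⊗ₜ 1 := by
  rw [Coaction.rho_eq_tmul_one_iff, mem_fixed]
  constructor
  · intro h ψ
    ext i
    have := congrArg ψ (h i)
    rw [act_coaction]
    simpa [Matrix.mulVec, dotProduct, mul_comm] using this
  · intro h i
    rw [← sub_eq_zero, ← Module.forall_dual_apply_eq_zero_iff k]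
    intro ψ
    have := congrFun (h ψ) i
    rw [act_coaction] at this
    rw [map_sub, sub_eq_zero]
    simpa [Matrix.mulVec, dotProduct, mul_comm] using this

/-- The vectors fixed by a normal closed subgroup scheme form a subrepresentation. -/
theorem mulVec_mem_fixed (hc : IsMulMat k c) {H : ClosedSubgrp k A} (hH : H.Normal)
    (ψ : A →ₗ[k] k) {x : ι → k} (hx : x ∈ fixed c H) : (c.map ψ).mulVec x ∈ fixed c H := by
  let g : A →ₐ[k] H.B ⊗[k] A := Algebra.TensorProduct.includeRight
  let f : A →ₐ[k] H.B ⊗[k] A := (Algebra.TensorProduct.includeLeft (R := k) (S := k)).comp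
    (H.π : A →ₐ[k] H.B)
  obtain ⟨f', ⟨p, hp⟩, hff'⟩ := hH _ f (ptInv g) ⟨_, rfl⟩
  have hcomm : ptMul f g = ptMul g f' := by
    have := congrArg (fun h => ptMul g (ptMul h g)) hff'
    simp only [ptMul_assoc, ptInv_ptMul, ptMul_ptOne] at this
    rwa [← ptMul_assoc, ptMul_ptInv, ptOne_ptMul] at this
  have hmat : c.map f * c.map g = c.map g * c.map f' := by
    rw [← hc.map_ptMul, ← hc.map_ptMul, hcomm]
  have hf' : ∀ l, ∑ j, x j • f' (c l j) = x l • 1 := by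
    intro l
    have := congrArg p (hx l)
    simpa [hp] using this
  intro i
  have h1 : ∑ j, x j • ∑ l, H.π (c i l) ⊗ₜ[k] c l j = ∑ l, x l • (1 : H.B) ⊗ₜ[k] c i l := by
    have h2 : ∀ j, ∑ l, H.π (c i l) ⊗ₜ[k] c l j = ∑ l, g (c i l) * f' (c l j) := by
      intro j
      have := congrFun₂ hmat i j
      simpa [Matrix.mul_apply, f, g] using this
    simp only [h2, Finset.smul_sum]
    rw [Finset.sum_comm]
    refine Finset.sum_congr rfl fun l _ => ?_
    simp only [← mul_smul_comm, ← Finset.mul_sum]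
    rw [hf', mul_smul_comm, mul_one]
    rfl
  have h3 := congrArg (TensorProduct.rid k H.B ∘ LinearMap.lTensor H.B ψ) h1
  simp only [Function.comp_apply, map_sum, map_smul, LinearMap.lTensor_tmul,
    TensorProduct.rid_tmul] at h3
  simp only [Matrix.mulVec, dotProduct, Matrix.map_apply, Finset.sum_smul, mul_comm (ψ _),
    mul_smul]
  rw [← h3, Finset.sum_comm]
  simp only [Finset.smul_sum]

theorem eq_bot_of_disjoint_fixed (hc : IsMulMat k c) {H : ClosedSubgrp k A}
    (hH : IsUnipotentHopf k H.B) {T : Submodule k (ι → k)}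
    (hT : ∀ ψ : A →ₗ[k] k, ∀ t ∈ T, (c.map ψ).mulVec t ∈ T) (hd : Disjoint (fixed c H) T) :
    T = ⊥ := by
  by_contra hne
  obtain ⟨v, hvT, hv0, hv⟩ := (hc.map_bialgHom H.π).coaction.exists_fixed_of_stable hH
    (W := T) (fun ψ w hw => by
      rw [act_coaction]
      exact hT (ψ ∘ₗ (H.π : A →ₗ[k] H.B)) w hw) hne
  exact hv0 (Submodule.disjoint_def.1 hd v (hc.mem_fixed_iff.2 hv) hvT)

theorem map_eq_one_of_fixed_eq_top {H : ClosedSubgrp k A} (h : fixed c H = ⊤) :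
    c.map H.π = 1 := by
  ext i j
  have := (mem_fixed.1 (h ▸ Submodule.mem_top : (Pi.single j 1 : ι → k) ∈ fixed c H)) i
  simpa [Pi.single_apply, Matrix.one_apply, eq_comm] using this

end IsMulMat

section Separable

variable {k K A A' : Type} [Field k] [Field K] [Algebra k K] [CommRing A] [HopfAlgebra k A]
  [CommRing A'] [HopfAlgebra K A'] [Algebra k A'] [IsScalarTower k K A']
  {u : A →ₐ[k] A'}

open scoped Matrix.Module in
/-- A subspace stable under the extensions of the `k`-linear functionals is stable under all
`K`-valued functionals. -/
theorem mulVec_mem_of_forall_smul_mem {ι : Type} [Fintype ι] [DecidableEq ι] (c : Matrix ι ι A)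
    {T : Submodule K (ι → K)} (hT : ∀ ψ : A →ₗ[k] k, ∀ t ∈ T, (c.map ψ) • t ∈ T)
    (lam : A →ₗ[k] K) {t : ι → K} (ht : t ∈ T) : (c.map lam).mulVec t ∈ T := by
  classical
  let e := Module.Basis.ofVectorSpace k K
  let s := Finset.univ.biUnion fun i => Finset.univ.biUnion fun j => (e.repr (lam (c i j))).support
  have hs : ∀ i j, lam (c i j) = ∑ α ∈ s, e.repr (lam (c i j)) α • e α := by
    intro i j
    conv_lhs => rw [← e.linearCombination_repr (lam (c i j)), Finsupp.linearCombination_apply]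
    refine Finsupp.sum_of_support_subset _ (fun α hα => ?_) _ (by simp)
    exact Finset.mem_biUnion.2 ⟨i, Finset.mem_univ _, Finset.mem_biUnion.2
      ⟨j, Finset.mem_univ _, hα⟩⟩
  have key : (c.map lam).mulVec t = ∑ α ∈ s, e α • ((c.map (e.coord α ∘ₗ lam)) • t) := by
    ext i
    simp only [Matrix.mulVec, dotProduct, Matrix.map_apply, Finset.sum_apply, Pi.smul_apply,
      Matrix.Module.smul_apply, Finset.smul_sum]
    rw [Finset.sum_comm]
    refine Finset.sum_congr rfl fun j _ => ?_
    rw [hs i j, Finset.sum_mul]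
    refine Finset.sum_congr rfl fun α _ => ?_
    simp [Algebra.smul_def]
    ring
  rw [key]
  exact Submodule.sum_mem _ fun α _ => Submodule.smul_mem _ _ (hT _ t ht)

open scoped Matrix.Module in
theorem IsHopfBaseChange.map_eq_one_of_isSimpleMat [Algebra.IsSeparable k K]
    (hu : IsHopfBaseChange K u) {H : ClosedSubgrp K A'} (hN : H.Normal)
    (hH : IsUnipotentHopf K H.B) {ι : Type} [Fintype ι] [DecidableEq ι] {c : Matrix ι ι A}
    (hc : IsMulMat k c) (hs : IsSimpleMat k c) : (c.map u).map H.π = 1 := by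
  have hc' := hu.isMulMat hc
  have hlift : ∀ (ψ : A →ₗ[k] k) (t : ι → K), (c.map ψ) • t = ((c.map u).map
      (hu.base.lift (Algebra.linearMap k K ∘ₗ ψ))).mulVec t := by
    intro ψ t
    ext i
    simp only [Matrix.Module.smul_apply, Matrix.mulVec, dotProduct, Matrix.map_apply]
    refine Finset.sum_congr rfl fun j _ => ?_
    have := hu.base.lift_eq (Algebra.linearMap k K ∘ₗ ψ) (c i j)
    rw [AlgHom.toLinearMap_apply] at this
    rw [this, Algebra.smul_def]
    rfl
  obtain ⟨T', hT', hst⟩ := exists_stable_isCompl (Set.range fun ψ : A →ₗ[k] k => c.map ψ)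
    (fun W hW => hs W fun ψ w hw => hW _ ⟨ψ, rfl⟩ w hw) (IsMulMat.fixed (c.map u) H) (by
      rintro _ ⟨ψ, rfl⟩ t ht
      rw [hlift]
      exact hc'.mulVec_mem_fixed hN _ ht)
  have hbot : T' = ⊥ := hc'.eq_bot_of_disjoint_fixed hH (fun ψ t ht =>
    mulVec_mem_of_forall_smul_mem c (fun φ t ht => hst _ ⟨φ, rfl⟩ t ht)
      (ψ.restrictScalars k ∘ₗ u.toLinearMap) ht) hT'.disjoint
  apply IsMulMat.map_eq_one_of_fixed_eq_top
  have := hT'.sup_eq_top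
  rwa [hbot, sup_bot_eq] at this

theorem IsHopfBaseChange.simpleKernel_mem [Algebra.IsSeparable k K] (hu : IsHopfBaseChange K u)
    {H : ClosedSubgrp K A'} (hN : H.Normal) (hH : IsUnipotentHopf K H.B) {R : Type} [CommRing R]
    [Algebra k R] [Algebra K R] [IsScalarTower k K R] {f : A' →ₐ[K] R} (hf : H.mem f) :
    (simpleKernel k A).mem ((f.restrictScalars k).comp u) := by
  obtain ⟨g, rfl⟩ := hf
  rw [simpleKernel_mem_iff]
  intro n c hc hs
  have h := hu.map_eq_one_of_isSimpleMat hN hH hc hs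
  have : c.map (((g.comp (H.π : A' →ₐ[K] H.B)).restrictScalars k).comp u) =
      ((c.map u).map H.π).map g := rfl
  rw [this, h, Matrix.map_one _ (map_zero g) (map_one g)]

end Separable

/-- **Theorem.** The formation of the restricted unipotent radical commutes with base
change along a separable algebraic field extension `K/k`: if `A'` presents the base
change `G_K` of `G = Spec A`, `U` is the restricted unipotent radical of `G` and `U'`
that of `G_K`, then `U'` and the base change of `U` have the same points: a point of
`G_K` lies in `U'` iff the corresponding point of `G` lies in `U`. -/
theorem radU_baseChange_separable (k K A A' : Type) [Field k] [Field K] [Algebra k K]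
    [Algebra.IsSeparable k K] [Algebra.IsAlgebraic k K]
    [CommRing A] [HopfAlgebra k A] (hft : Algebra.FiniteType k A)
    [CommRing A'] [HopfAlgebra K A'] (P : BaseChangePresentation k K A A')
    (U : ClosedSubgrp k A) (hU : IsRadU U)
    (U' : ClosedSubgrp K A') (hU' : IsRadU U') :
    ∀ (R : Type) (iR : CommRing R) (ik : Algebra k R) (iK : Algebra K R)
      (it : IsScalarTower k K R), ∀ f : A' →ₐ[K] R,
      U'.mem f ↔ U.mem (P.e R iR ik iK it f) := by
  let _ : Algebra k A' := Algebra.compHom A' (algebraMap k K)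
  have : IsScalarTower k K A' := IsScalarTower.of_algebraMap_eq fun _ => rfl
  obtain ⟨u, hu, he⟩ := P.exists_isHopfBaseChange
  intro R iR ik iK it f
  rw [he]
  constructor
  · intro hf
    exact hU.2.2 (simpleKernel k A) simpleKernel_normal (isUnipotentHopf_simpleKernel k A) R _
      (hu.simpleKernel_mem hU'.1 hU'.2.1 hf)
  · intro hf
    obtain ⟨H, hH, hmem⟩ := hu.exists_baseChange U
    exact hU'.2.2 H (hu.normal_of_mem_iff hU.1 hmem) (hH hU.2.1) R f ((hmem f).2 hf)

end
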